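/- Let $n \ge 2$, let $i \ne j$ be elements of $[n]$, let $D \subseteq [n] \setminus \{i,j\}$ and set $k = |D|$. Equip $\Omega_n = ([0,1]^2)^n$ with the uniform probability measure (the product of $n$ copies of two-dimensional Lebesgue measure restricted to $[0,1]^2$), and let $\le$ denote the coordinatewise partial order on $\mathbb{R}^2$ and $q \vee q'$ the coordinatewise maximum. Let $R_{i,j,D}$ be the set of $q = (q_1,\ldots,q_n) \in \Omega_n$ such that: (C1) $q_i$ and $q_j$ are minimal elements of $\{q_1,\ldots,q_n\}$ with respect to $\le$ (i.e. there is no $t$ with $q_t \le q_i$ and $q_t \ne q_i$, and likewise for $q_j$); and (C2) $D = \{t \in [n] \setminus \{i,j\} : q_t \not\ge q_i \vee q_j\}$. Then $\Pr[R_{i,j,D}] \le \frac{20}{k+2}\binom{n}{2}^{-1}\binom{n-2}{k}^{-1}\big(1+\log(k+1)\big)$. -/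

import Mathlib

open MeasureTheory

section MinimalPairs

open Finset

theorem sum_antidiagonal_choose_mul_choose (m a M : ℕ) :
    ∑ p ∈ antidiagonal M, ((m + p.1).choose m : ℝ) * ((a + p.2).choose a : ℝ) =
      ((m + a + 1 + M).choose M : ℝ) := by
  have h : (PowerSeries.invOneSubPow ℝ ((m + 1) + (a + 1))).val =
      (PowerSeries.invOneSubPow ℝ (m + 1)).val * (PowerSeries.invOneSubPow ℝ (a + 1)).val := by
    rw [PowerSeries.invOneSubPow_add, Units.val_mul]
  have h2 := congrArg (PowerSeries.coeff M) h
  rw [show m + 1 + (a + 1) = (m + a + 1) + 1 by ring] at h2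
  simp only [PowerSeries.invOneSubPow_val_succ_eq_mk_add_choose, PowerSeries.coeff_mul,
    PowerSeries.coeff_mk] at h2
  rw [← h2, Nat.choose_symm_add]

theorem integral_pow_mul_one_sub_pow (p q : ℕ) :
    ∫ x in (0:ℝ)..1, x ^ p * (1 - x) ^ q =
      (p.factorial : ℝ) * q.factorial / ((p + q + 1).factorial : ℝ) := by
  induction q generalizing p with
  | zero =>
    simp [integral_pow, Nat.factorial_succ]
    field_simp
  | succ q ih =>
    have h := intervalIntegral.integral_mul_deriv_eq_deriv_mul (a := 0) (b := 1)
      (u := fun x : ℝ => (1 - x) ^ (q + 1)) (v := fun x : ℝ => x ^ (p + 1) / (p + 1))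
      (u' := fun x => -((q + 1) * (1 - x) ^ q)) (v' := fun x => x ^ p)
      (fun x _ => by
        have := ((hasDerivAt_id x).const_sub 1).pow (q + 1)
        convert this using 1
        · rfl
        · simp)
      (fun x _ => by
        have := (hasDerivAt_pow (p + 1) x).div_const (p + 1 : ℝ)
        convert this using 1
        push_cast; field_simp)
      (Continuous.intervalIntegrable (by fun_prop) _ _)
      (Continuous.intervalIntegrable (by fun_prop) _ _)
    have h3 : ∀ x : ℝ, x ^ p * (1 - x) ^ (q + 1) = (1 - x) ^ (q + 1) * x ^ p := fun x => by ring
    have h4 : ∀ x : ℝ, -((q + 1) * (1 - x) ^ q) * (x ^ (p + 1) / (p + 1)) =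
      -((q + 1) / (p + 1)) * (x ^ (p + 1) * (1 - x) ^ q) := fun x => by ring
    simp only [h3]
    rw [h]
    simp only [h4]
    rw [intervalIntegral.integral_const_mul, ih (p + 1)]
    rw [show p + 1 + q + 1 = p + (q + 1) + 1 by ring, Nat.factorial_succ p, Nat.factorial_succ q]
    push_cast
    simp
    field_simp

theorem sum_antidiagonal_antidiagonal_swap (f : ℕ → ℕ → ℕ → ℝ) (k : ℕ) :
    ∑ p ∈ antidiagonal k, ∑ r ∈ antidiagonal p.2, f p.1 r.1 r.2 =
      ∑ p ∈ antidiagonal k, ∑ r ∈ antidiagonal p.2, f r.1 p.1 r.2 := by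
  rw [sum_sigma', sum_sigma']
  refine sum_nbij' (fun x => ⟨(x.2.1, x.1.1 + x.2.2), (x.1.1, x.2.2)⟩)
    (fun x => ⟨(x.2.1, x.1.1 + x.2.2), (x.1.1, x.2.2)⟩) ?_ ?_ ?_ ?_ ?_
  · rintro ⟨⟨a, s⟩, b, c⟩ h
    simp only [mem_sigma, HasAntidiagonal.mem_antidiagonal, and_true] at h ⊢
    omega
  · rintro ⟨⟨a, s⟩, b, c⟩ h
    simp only [mem_sigma, HasAntidiagonal.mem_antidiagonal, and_true] at h ⊢
    omega
  · rintro ⟨⟨a, s⟩, b, c⟩ h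
    simp only [mem_sigma, HasAntidiagonal.mem_antidiagonal] at h
    simp [h.2]
  · rintro ⟨⟨a, s⟩, b, c⟩ h
    simp only [mem_sigma, HasAntidiagonal.mem_antidiagonal] at h
    simp [h.2]
  · rintro ⟨⟨a, s⟩, b, c⟩ h
    rfl

theorem sum_antidiagonal_factorial (m a M : ℕ) :
    ∑ r ∈ antidiagonal M, ((a + r.2).factorial * M.factorial * (a + m).factorial *
        (r.1 + m).factorial / (a.factorial * r.1.factorial * r.2.factorial) : ℝ) =
      m.factorial * (m + a + M + 1).factorial / (m + a + 1) := by
  have h : ∀ r ∈ antidiagonal M, ((a + r.2).factorial * M.factorial * (a + m).factorial *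
        (r.1 + m).factorial / (a.factorial * r.1.factorial * r.2.factorial) : ℝ) =
      (m.factorial * M.factorial * (a + m).factorial) *
        (((m + r.1).choose m : ℝ) * ((a + r.2).choose a : ℝ)) := by
    intro r _
    rw [Nat.cast_add_choose, Nat.cast_add_choose, add_comm r.1 m]
    field_simp
  rw [sum_congr rfl h, ← mul_sum, sum_antidiagonal_choose_mul_choose, ← Nat.choose_symm_add,
    Nat.cast_add_choose, Nat.factorial_succ (m + a), add_comm a m,
    show m + a + 1 + M = m + a + M + 1 by ring]
  push_cast
  field_simp

theorem sum_antidiagonal_factorial_le (m a s : ℕ) :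
    ∑ r ∈ antidiagonal s, ((a + r.2 + 2).factorial * (r.1 + r.2 + 2).factorial *
        (a + m).factorial * (r.1 + m).factorial /
        (a.factorial * r.1.factorial * (r.2 + 2).factorial) : ℝ) ≤
      m.factorial * (m + a + s + 3).factorial / (m + a + 1) := by
  have h := sum_antidiagonal_factorial m a (s + 2)
  rw [Nat.sum_antidiagonal_succ', Nat.sum_antidiagonal_succ'] at h
  rw [show m + a + s + 3 = m + a + (s + 2) + 1 by ring, ← h, ← add_assoc]
  refine le_add_of_nonneg_of_le (by positivity) (le_of_eq (sum_congr rfl fun r hr => ?_))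
  rw [HasAntidiagonal.mem_antidiagonal] at hr
  simp only [hr, add_assoc, Nat.reduceAdd]

theorem factorial_term_le (m a b c k : ℕ) (h : a + b + c = k) :
    ((a + c + 1).factorial * (b + c + 1).factorial * (a + m).factorial * (b + m).factorial /
        (a.factorial * b.factorial * c.factorial * (c + 1) ^ 2) : ℝ) ≤
      2 / (k + 4) * (((a + c + 2).factorial * (b + c + 2).factorial *
        (a + m).factorial * (b + m).factorial /
        (a.factorial * b.factorial * (c + 2).factorial)) / (b + c + 2) +
        ((b + c + 2).factorial * (a + c + 2).factorial *
        (b + m).factorial * (a + m).factorial /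
        (b.factorial * a.factorial * (c + 2).factorial)) / (a + c + 2) : ℝ) := by
  set W : ℝ := (a + c + 1).factorial * (b + c + 1).factorial * (a + m).factorial *
    (b + m).factorial / (a.factorial * b.factorial * c.factorial) with hW
  have hW0 : 0 ≤ W := by positivity
  have h1 : ((a + c + 1).factorial * (b + c + 1).factorial * (a + m).factorial *
      (b + m).factorial / (a.factorial * b.factorial * c.factorial * (c + 1) ^ 2) : ℝ) =
      W * (1 / (c + 1) ^ 2) := by rw [hW]; field_simp
  have h2 : 2 / (k + 4) * (((a + c + 2).factorial * (b + c + 2).factorial *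
        (a + m).factorial * (b + m).factorial /
        (a.factorial * b.factorial * (c + 2).factorial)) / (b + c + 2) +
        ((b + c + 2).factorial * (a + c + 2).factorial *
        (b + m).factorial * (a + m).factorial /
        (b.factorial * a.factorial * (c + 2).factorial)) / (a + c + 2) : ℝ) =
      W * (2 * (a + b + 2 * c + 4) / ((k + 4) * ((c + 1) * (c + 2)))) := by
    rw [hW, Nat.factorial_succ (a + c + 1), Nat.factorial_succ (b + c + 1),
      Nat.factorial_succ (c + 1), Nat.factorial_succ c]
    push_cast
    field_simp
    ring
  rw [h1, h2]
  refine mul_le_mul_of_nonneg_left ?_ hW0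
  have hk : (k : ℝ) = a + b + c := by rw [← h]; push_cast; ring
  rw [hk, div_le_div_iff₀ (by positivity) (by positivity)]
  have : (0 : ℝ) ≤ (c + 1) * ((a + b + c + 4) * c + 2 * c * (c + 1)) := by positivity
  nlinarith

theorem sum_inv_antidiagonal (k : ℕ) :
    ∑ p ∈ antidiagonal k, ((p.1 : ℝ) + 1)⁻¹ ≤ 1 + Real.log (k + 1) := by
  have h := harmonic_le_one_add_log (k + 1)
  rw [harmonic] at h
  rw [Nat.sum_antidiagonal_eq_sum_range_succ_mk]
  push_cast at h
  exact h

theorem sum_factorial_le (m k : ℕ) :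
    ∑ p ∈ antidiagonal k, ∑ r ∈ antidiagonal p.2,
      ((p.1 + r.2 + 1).factorial * (r.1 + r.2 + 1).factorial * (p.1 + m).factorial *
        (r.1 + m).factorial /
        (p.1.factorial * r.1.factorial * r.2.factorial * (r.2 + 1) ^ 2) : ℝ) ≤
      8 / (k + 4) * (m.factorial * (m + k + 2).factorial) * (1 + Real.log (k + 1)) := by
  let U : ℕ → ℕ → ℕ → ℝ := fun a b c => ((a + c + 2).factorial * (b + c + 2).factorial *
        (a + m).factorial * (b + m).factorial /
        (a.factorial * b.factorial * (c + 2).factorial)) / (b + c + 2)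
  have hU : ∑ p ∈ antidiagonal k, ∑ r ∈ antidiagonal p.2, U p.1 r.1 r.2 ≤
      2 * (m.factorial * (m + k + 2).factorial) * (1 + Real.log (k + 1)) := by
    have h1 : ∀ p ∈ antidiagonal k, ∑ r ∈ antidiagonal p.2, U p.1 r.1 r.2 ≤
        (m.factorial * (m + k + 2).factorial) * (((p.1 : ℝ) + 1)⁻¹ + ((p.2 : ℝ) + 1)⁻¹) := by
      intro p hp
      rw [HasAntidiagonal.mem_antidiagonal] at hp
      have h2 : ∑ r ∈ antidiagonal p.2, U p.1 r.1 r.2 ≤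
          (m.factorial * (m + p.1 + p.2 + 3).factorial / (m + p.1 + 1)) / (p.2 + 2) := by
        refine le_trans (le_of_eq ?_) (div_le_div_of_nonneg_right
          (sum_antidiagonal_factorial_le m p.1 p.2) (by positivity : (0 : ℝ) ≤ p.2 + 2))
        rw [sum_div]
        refine sum_congr rfl fun r hr => ?_
        rw [HasAntidiagonal.mem_antidiagonal] at hr
        simp only [U, ← hr, Nat.cast_add]
      refine h2.trans ?_
      rw [show m + p.1 + p.2 + 3 = (m + k + 2) + 1 by omega, Nat.factorial_succ]
      have h3 : (m.factorial * ((m + k + 2 + 1 : ℕ) * (m + k + 2).factorial : ℕ) /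
          (m + p.1 + 1) / (p.2 + 2) : ℝ) =
          (m.factorial * (m + k + 2).factorial) *
          (((m : ℝ) + p.1 + 1)⁻¹ + ((p.2 : ℝ) + 2)⁻¹) := by
        rw [← hp]
        push_cast
        field_simp
        ring
      rw [h3]
      gcongr
      · linarith [(Nat.cast_nonneg m : (0 : ℝ) ≤ m)]
      · norm_num
    refine (sum_le_sum h1).trans ?_
    rw [← mul_sum, sum_add_distrib]
    have h4 := sum_inv_antidiagonal k
    have h5 : ∑ p ∈ antidiagonal k, ((p.2 : ℝ) + 1)⁻¹ ≤ 1 + Real.log (k + 1) := by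
      rw [← Nat.sum_antidiagonal_swap]
      exact h4
    have h6 : (0 : ℝ) ≤ m.factorial * (m + k + 2).factorial := by positivity
    nlinarith
  have h7 : ∑ p ∈ antidiagonal k, ∑ r ∈ antidiagonal p.2,
      ((p.1 + r.2 + 1).factorial * (r.1 + r.2 + 1).factorial * (p.1 + m).factorial *
        (r.1 + m).factorial /
        (p.1.factorial * r.1.factorial * r.2.factorial * (r.2 + 1) ^ 2) : ℝ) ≤
      ∑ p ∈ antidiagonal k, ∑ r ∈ antidiagonal p.2,
        2 / (k + 4) * (U p.1 r.1 r.2 + U r.1 p.1 r.2) := by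
    refine sum_le_sum fun p hp => sum_le_sum fun r hr => ?_
    rw [HasAntidiagonal.mem_antidiagonal] at hp hr
    exact factorial_term_le m p.1 r.1 r.2 k (by omega)
  refine h7.trans ?_
  simp only [← mul_sum, sum_add_distrib]
  rw [← sum_antidiagonal_antidiagonal_swap U k]
  calc _ ≤ 2 / (k + 4 : ℝ) * (2 * (m.factorial * (m + k + 2).factorial) * (1 + Real.log (k + 1)) +
        2 * (m.factorial * (m + k + 2).factorial) * (1 + Real.log (k + 1))) := by gcongr
    _ = _ := by ring

/-- The uniform probability measure on the unit interval. -/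
noncomputable abbrev unitMeasure : Measure ℝ := volume.restrict (Set.Icc (0 : ℝ) 1)

/-- The density `x ^ p * (1 - x) ^ q * (x - a) ^ c` on the triangle `0 ≤ a ≤ x ≤ 1`. -/
noncomputable def triangleDensity (p q c : ℕ) (x a : ℝ) : ENNReal :=
  {z : ℝ × ℝ | 0 ≤ z.2 ∧ z.2 ≤ z.1 ∧ z.1 ≤ 1}.indicator
    (fun z => ENNReal.ofReal (z.1 ^ p * (1 - z.1) ^ q * (z.1 - z.2) ^ c)) (x, a)

theorem measurable_triangleDensity (p q c : ℕ) :
    Measurable fun z : ℝ × ℝ => triangleDensity p q c z.1 z.2 := by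
  unfold triangleDensity
  refine Measurable.indicator (by fun_prop) ?_
  refine (measurableSet_le measurable_const measurable_snd).inter
    ((measurableSet_le measurable_snd measurable_fst).inter
      (measurableSet_le measurable_fst measurable_const))

theorem lintegral_Icc_ofReal {f : ℝ → ℝ} {b : ℝ} (hb : 0 ≤ b) (hf : Continuous f)
    (h0 : ∀ x ∈ Set.Icc 0 b, 0 ≤ f x) :
    ∫⁻ x in Set.Icc 0 b, ENNReal.ofReal (f x) = ENNReal.ofReal (∫ x in (0 : ℝ)..b, f x) := by
  rw [intervalIntegral.integral_of_le hb, ← integral_Icc_eq_integral_Ioc,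
    ofReal_integral_eq_lintegral_ofReal]
  · exact hf.continuousOn.integrableOn_Icc
  · exact ae_restrict_of_forall_mem measurableSet_Icc h0

theorem lintegral_triangleDensity_right (p q c : ℕ) {x : ℝ} (h0 : 0 ≤ x) (h1 : x ≤ 1) :
    ∫⁻ a, triangleDensity p q c x a ∂unitMeasure =
      ENNReal.ofReal (x ^ (p + c + 1) * (1 - x) ^ q / (c + 1)) := by
  have h : ∀ a, triangleDensity p q c x a = (Set.Icc 0 x).indicator
      (fun a => ENNReal.ofReal (x ^ p * (1 - x) ^ q * (x - a) ^ c)) a := by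
    intro a
    simp only [triangleDensity, Set.indicator, Set.mem_ofPred_eq, Set.mem_Icc, h1, and_true]
  simp only [h]
  rw [lintegral_indicator measurableSet_Icc, Measure.restrict_restrict measurableSet_Icc,
    Set.inter_eq_left.2 (Set.Icc_subset_Icc_right h1), lintegral_Icc_ofReal h0 (by fun_prop)]
  · rw [intervalIntegral.integral_const_mul, intervalIntegral.integral_comp_sub_left
      (fun y => y ^ c)]
    simp only [sub_self, sub_zero, integral_pow]
    congr 1
    simp
    ring
  · intro a ha
    have : 0 ≤ x - a := sub_nonneg.2 ha.2
    have : 0 ≤ 1 - x := sub_nonneg.2 h1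
    positivity

theorem lintegral_triangleDensity (p q c : ℕ) :
    ∫⁻ x, ∫⁻ a, triangleDensity p q c x a ∂unitMeasure ∂unitMeasure =
      ENNReal.ofReal ((p + c + 1).factorial * q.factorial /
        ((c + 1) * (p + c + 1 + q + 1).factorial)) := by
  rw [setLIntegral_congr_fun measurableSet_Icc
    (fun x hx => lintegral_triangleDensity_right p q c hx.1 hx.2),
    lintegral_Icc_ofReal zero_le_one (by fun_prop)]
  · rw [intervalIntegral.integral_div, integral_pow_mul_one_sub_pow]
    congr 1
    field_simp
  · intro x hx
    have : 0 ≤ 1 - x := sub_nonneg.2 hx.2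
    have := hx.1
    positivity

theorem lintegral_triangleDensity_swap (p q c : ℕ) :
    ∫⁻ a, ∫⁻ x, triangleDensity p q c x a ∂unitMeasure ∂unitMeasure =
      ENNReal.ofReal ((p + c + 1).factorial * q.factorial /
        ((c + 1) * (p + c + 1 + q + 1).factorial)) := by
  rw [← lintegral_triangleDensity, lintegral_lintegral_swap]
  exact ((measurable_triangleDensity p q c).comp measurable_swap).aemeasurable

/-- For `z = (a, y)` and `w = (x, b)` in the unit square with `a ≤ x` and `b ≤ y`, a bound for the
conditional probability that the remaining points are placed as required. -/
noncomputable def pairDensity (k m : ℕ) (z w : ℝ × ℝ) : ENNReal :=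
  {v : (ℝ × ℝ) × (ℝ × ℝ) | v.1.1 ≤ v.2.1 ∧ v.2.2 ≤ v.1.2}.indicator
    (fun v => ENNReal.ofReal ((v.2.1 * (1 - v.1.2) + (v.1.2 * (1 - v.2.1) +
      (v.2.1 - v.1.1) * (v.1.2 - v.2.2))) ^ k * ((1 - v.2.1) * (1 - v.1.2)) ^ m)) (z, w)

theorem measurable_pairDensity (k m : ℕ) :
    Measurable fun v : (ℝ × ℝ) × (ℝ × ℝ) => pairDensity k m v.1 v.2 := by
  unfold pairDensity
  refine Measurable.indicator (by fun_prop) ?_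
  exact (measurableSet_le measurable_fst.fst measurable_snd.fst).inter
    (measurableSet_le measurable_snd.snd measurable_fst.snd)

theorem sum_antidiagonal_ofReal (f : ℕ × ℕ → ℕ × ℕ → ℝ) (hf : ∀ p r, 0 ≤ f p r) (k : ℕ) :
    ∑ p ∈ antidiagonal k, ∑ r ∈ antidiagonal p.2, ENNReal.ofReal (f p r) =
      ENNReal.ofReal (∑ p ∈ antidiagonal k, ∑ r ∈ antidiagonal p.2, f p r) := by
  rw [ENNReal.ofReal_sum_of_nonneg fun p _ => sum_nonneg fun r _ => hf p r]
  exact sum_congr rfl fun p _ => (ENNReal.ofReal_sum_of_nonneg fun r _ => hf p r).symm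

theorem pairDensity_eq_sum (k m : ℕ) {z w : ℝ × ℝ}
    (hz : z ∈ Set.Icc (0 : ℝ) 1 ×ˢ Set.Icc (0 : ℝ) 1)
    (hw : w ∈ Set.Icc (0 : ℝ) 1 ×ˢ Set.Icc (0 : ℝ) 1) :
    pairDensity k m z w = ∑ p ∈ antidiagonal k, ∑ r ∈ antidiagonal p.2,
      ENNReal.ofReal (k.choose p.1 * p.2.choose r.1) *
        (triangleDensity p.1 (r.1 + m) r.2 w.1 z.1 *
          triangleDensity r.1 (p.1 + m) r.2 z.2 w.2) := by
  obtain ⟨a, y⟩ := z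
  obtain ⟨x, b⟩ := w
  obtain ⟨⟨ha0, ha1⟩, hy0, hy1⟩ := hz
  obtain ⟨⟨hx0, hx1⟩, hb0, hb1⟩ := hw
  dsimp only at *
  simp only [pairDensity, triangleDensity, Set.indicator, Set.mem_ofPred_eq, ha0, hx1, hb0, hy1,
    true_and, and_true]
  by_cases h1 : a ≤ x
  swap
  · simp [h1]
  by_cases h2 : b ≤ y
  swap
  · simp [h2]
  simp only [h1, h2, and_self, if_true]
  have hxa : 0 ≤ x - a := sub_nonneg.2 h1
  have hyb : 0 ≤ y - b := sub_nonneg.2 h2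
  have hx : 0 ≤ 1 - x := sub_nonneg.2 hx1
  have hy : 0 ≤ 1 - y := sub_nonneg.2 hy1
  have h3 : ∀ p r : ℕ × ℕ, ENNReal.ofReal (k.choose p.1 * p.2.choose r.1) *
      (ENNReal.ofReal (x ^ p.1 * (1 - x) ^ (r.1 + m) * (x - a) ^ r.2) *
        ENNReal.ofReal (y ^ r.1 * (1 - y) ^ (p.1 + m) * (y - b) ^ r.2)) =
      ENNReal.ofReal ((k.choose p.1 * p.2.choose r.1) *
        ((x ^ p.1 * (1 - x) ^ (r.1 + m) * (x - a) ^ r.2) *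
        (y ^ r.1 * (1 - y) ^ (p.1 + m) * (y - b) ^ r.2))) := by
    intro p r
    rw [← ENNReal.ofReal_mul (by positivity), ← ENNReal.ofReal_mul (by positivity)]
  simp only [h3]
  rw [sum_antidiagonal_ofReal _ fun _ _ => by positivity]
  congr 1
  rw [(Commute.all _ _).add_pow', sum_mul]
  refine sum_congr rfl fun p _ => ?_
  rw [(Commute.all _ _).add_pow', mul_sum, smul_sum, sum_mul]
  refine sum_congr rfl fun r _ => ?_
  simp only [nsmul_eq_mul, mul_pow, pow_add]
  ring

theorem lintegral_triangleDensity_mul (p q c p' q' c' : ℕ) :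
    ∫⁻ z, ∫⁻ w, triangleDensity p q c w.1 z.1 * triangleDensity p' q' c' z.2 w.2
      ∂(unitMeasure.prod unitMeasure) ∂(unitMeasure.prod unitMeasure) =
    ENNReal.ofReal ((p + c + 1).factorial * q.factorial /
        ((c + 1) * (p + c + 1 + q + 1).factorial)) *
      ENNReal.ofReal ((p' + c' + 1).factorial * q'.factorial /
        ((c' + 1) * (p' + c' + 1 + q' + 1).factorial)) := by
  have h : ∀ z : ℝ × ℝ, ∫⁻ w, triangleDensity p q c w.1 z.1 * triangleDensity p' q' c' z.2 w.2
      ∂(unitMeasure.prod unitMeasure) = (∫⁻ x, triangleDensity p q c x z.1 ∂unitMeasure) *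
        ∫⁻ b, triangleDensity p' q' c' z.2 b ∂unitMeasure := fun z =>
    lintegral_prod_mul
      (f := fun x => triangleDensity p q c x z.1) (g := fun b => triangleDensity p' q' c' z.2 b)
      ((measurable_triangleDensity p q c).comp measurable_prodMk_right).aemeasurable
      ((measurable_triangleDensity p' q' c').comp measurable_prodMk_left).aemeasurable
  simp only [h]
  rw [lintegral_prod_mul (f := fun a => ∫⁻ x, triangleDensity p q c x a ∂unitMeasure)
    (g := fun y => ∫⁻ b, triangleDensity p' q' c' y b ∂unitMeasure),
    lintegral_triangleDensity_swap, lintegral_triangleDensity]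
  · exact (Measurable.lintegral_prod_left (measurable_triangleDensity p q c)).aemeasurable
  · exact (Measurable.lintegral_prod_right (measurable_triangleDensity p' q' c')).aemeasurable

/-- The uniform probability measure on the unit square. -/
noncomputable abbrev squareMeasure : Measure (ℝ × ℝ) :=
  volume.restrict (Set.Icc (0 : ℝ) 1 ×ˢ Set.Icc (0 : ℝ) 1)

theorem squareMeasure_eq_prod : squareMeasure = unitMeasure.prod unitMeasure := by
  rw [Measure.prod_restrict, ← Measure.volume_eq_prod]

theorem measurableSet_square :
    MeasurableSet (Set.Icc (0 : ℝ) 1 ×ˢ Set.Icc (0 : ℝ) 1) :=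
  measurableSet_Icc.prod measurableSet_Icc

theorem lintegral_pairDensity_le (k m : ℕ) :
    ∫⁻ z, ∫⁻ w, pairDensity k m z w ∂squareMeasure ∂squareMeasure ≤
      ENNReal.ofReal (8 / (k + 4) * (k.factorial * m.factorial / (m + k + 2).factorial) *
        (1 + Real.log (k + 1))) := by
  have h1 : ∫⁻ z, ∫⁻ w, pairDensity k m z w ∂squareMeasure ∂squareMeasure =
      ∫⁻ z, ∫⁻ w, ∑ p ∈ antidiagonal k, ∑ r ∈ antidiagonal p.2,
      ENNReal.ofReal (k.choose p.1 * p.2.choose r.1) *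
        (triangleDensity p.1 (r.1 + m) r.2 w.1 z.1 *
          triangleDensity r.1 (p.1 + m) r.2 z.2 w.2) ∂squareMeasure ∂squareMeasure :=
    setLIntegral_congr_fun measurableSet_square fun z hz =>
      setLIntegral_congr_fun measurableSet_square fun w hw => pairDensity_eq_sum k m hz hw
  have hm : ∀ p r : ℕ × ℕ, Measurable fun v : (ℝ × ℝ) × (ℝ × ℝ) =>
      ENNReal.ofReal (k.choose p.1 * p.2.choose r.1) *
        (triangleDensity p.1 (r.1 + m) r.2 v.2.1 v.1.1 *
          triangleDensity r.1 (p.1 + m) r.2 v.1.2 v.2.2) := fun p r => by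
    refine Measurable.const_mul (Measurable.mul ?_ ?_) _
    · exact (measurable_triangleDensity p.1 (r.1 + m) r.2).comp
        (f := fun v : (ℝ × ℝ) × (ℝ × ℝ) => (v.2.1, v.1.1)) (by fun_prop)
    · exact (measurable_triangleDensity r.1 (p.1 + m) r.2).comp
        (f := fun v : (ℝ × ℝ) × (ℝ × ℝ) => (v.1.2, v.2.2)) (by fun_prop)
  have hm' : ∀ p r : ℕ × ℕ, ∀ z : ℝ × ℝ, Measurable fun w : ℝ × ℝ =>
      ENNReal.ofReal (k.choose p.1 * p.2.choose r.1) *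
        (triangleDensity p.1 (r.1 + m) r.2 w.1 z.1 *
          triangleDensity r.1 (p.1 + m) r.2 z.2 w.2) := fun p r z =>
    (hm p r).comp measurable_prodMk_left
  have h2 : ∀ z : ℝ × ℝ, ∫⁻ w, ∑ p ∈ antidiagonal k, ∑ r ∈ antidiagonal p.2,
      ENNReal.ofReal (k.choose p.1 * p.2.choose r.1) *
        (triangleDensity p.1 (r.1 + m) r.2 w.1 z.1 *
          triangleDensity r.1 (p.1 + m) r.2 z.2 w.2) ∂squareMeasure =
      ∑ p ∈ antidiagonal k, ∑ r ∈ antidiagonal p.2, ∫⁻ w,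
      ENNReal.ofReal (k.choose p.1 * p.2.choose r.1) *
        (triangleDensity p.1 (r.1 + m) r.2 w.1 z.1 *
          triangleDensity r.1 (p.1 + m) r.2 z.2 w.2) ∂squareMeasure := fun z => by
    rw [lintegral_finsetSum _ fun p _ => Finset.measurable_sum _ fun r _ => hm' p r z]
    exact sum_congr rfl fun p _ => lintegral_finsetSum _ fun r _ => hm' p r z
  have h3 : ∫⁻ z, ∑ p ∈ antidiagonal k, ∑ r ∈ antidiagonal p.2, ∫⁻ w,
      ENNReal.ofReal (k.choose p.1 * p.2.choose r.1) *
        (triangleDensity p.1 (r.1 + m) r.2 w.1 z.1 *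
          triangleDensity r.1 (p.1 + m) r.2 z.2 w.2) ∂squareMeasure ∂squareMeasure =
      ∑ p ∈ antidiagonal k, ∑ r ∈ antidiagonal p.2, ∫⁻ z, ∫⁻ w,
      ENNReal.ofReal (k.choose p.1 * p.2.choose r.1) *
        (triangleDensity p.1 (r.1 + m) r.2 w.1 z.1 *
          triangleDensity r.1 (p.1 + m) r.2 z.2 w.2) ∂squareMeasure ∂squareMeasure := by
    rw [lintegral_finsetSum _ fun p _ => Finset.measurable_sum _ fun r _ =>
      (hm p r).lintegral_prod_right]
    exact sum_congr rfl fun p _ => lintegral_finsetSum _ fun r _ =>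
      (hm p r).lintegral_prod_right
  have h4 : ∀ p ∈ antidiagonal k, ∀ r ∈ antidiagonal p.2, ∫⁻ z, ∫⁻ w,
      ENNReal.ofReal (k.choose p.1 * p.2.choose r.1) *
        (triangleDensity p.1 (r.1 + m) r.2 w.1 z.1 *
          triangleDensity r.1 (p.1 + m) r.2 z.2 w.2) ∂squareMeasure ∂squareMeasure =
      ENNReal.ofReal (k.factorial / (m + k + 2).factorial ^ 2 *
        ((p.1 + r.2 + 1).factorial * (r.1 + r.2 + 1).factorial * (p.1 + m).factorial *
        (r.1 + m).factorial /
        (p.1.factorial * r.1.factorial * r.2.factorial * (r.2 + 1) ^ 2))) := by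
    intro p hp r hr
    rw [HasAntidiagonal.mem_antidiagonal] at hp hr
    simp_rw [lintegral_const_mul' _ _ ENNReal.ofReal_ne_top]
    rw [squareMeasure_eq_prod, lintegral_triangleDensity_mul,
      ← ENNReal.ofReal_mul (by positivity), ← ENNReal.ofReal_mul (by positivity)]
    congr 1
    rw [show p.1 + r.2 + 1 + (r.1 + m) + 1 = m + k + 2 by omega,
      show r.1 + r.2 + 1 + (p.1 + m) + 1 = m + k + 2 by omega, ← hp, Nat.cast_add_choose, ← hr,
      Nat.cast_add_choose]
    field_simp
  rw [h1]
  simp only [h2]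
  rw [h3, sum_congr rfl fun p hp => sum_congr rfl (h4 p hp)]
  rw [sum_antidiagonal_ofReal _ fun _ _ => by positivity]
  refine ENNReal.ofReal_le_ofReal ?_
  simp only [← mul_sum]
  refine (mul_le_mul_of_nonneg_left (sum_factorial_le m k) (by positivity)).trans (le_of_eq ?_)
  field_simp

theorem squareMeasure_Ici_le (z : ℝ × ℝ) (hz : z ∈ Set.Icc (0 : ℝ) 1 ×ˢ Set.Icc (0 : ℝ) 1) :
    squareMeasure (Set.Ici z) ≤ ENNReal.ofReal ((1 - z.1) * (1 - z.2)) := by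
  rw [Measure.restrict_apply' measurableSet_square]
  have h : Set.Ici z ∩ (Set.Icc (0 : ℝ) 1 ×ˢ Set.Icc (0 : ℝ) 1) ⊆
      Set.Icc z.1 1 ×ˢ Set.Icc z.2 1 :=
    fun v hv => ⟨⟨hv.1.1, hv.2.1.2⟩, hv.1.2, hv.2.2.2⟩
  refine (measure_mono h).trans (le_of_eq ?_)
  rw [Measure.volume_eq_prod, Measure.prod_prod, Real.volume_Icc, Real.volume_Icc,
    ENNReal.ofReal_mul (sub_nonneg.2 hz.1.2)]

theorem squareMeasure_not_sup_le (z w : ℝ × ℝ)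
    (hz : z ∈ Set.Icc (0 : ℝ) 1 ×ˢ Set.Icc (0 : ℝ) 1)
    (hw : w ∈ Set.Icc (0 : ℝ) 1 ×ˢ Set.Icc (0 : ℝ) 1) (h1 : z.1 ≤ w.1) (h2 : w.2 ≤ z.2) :
    squareMeasure {v | (v ≤ z → v = z) ∧ (v ≤ w → v = w) ∧ ¬ z ⊔ w ≤ v} ≤
      ENNReal.ofReal (w.1 * (1 - z.2) + (z.2 * (1 - w.1) + (w.1 - z.1) * (z.2 - w.2))) := by
  rw [Measure.restrict_apply' measurableSet_square]
  have h : {v | (v ≤ z → v = z) ∧ (v ≤ w → v = w) ∧ ¬ z ⊔ w ≤ v} ∩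
      (Set.Icc (0 : ℝ) 1 ×ˢ Set.Icc (0 : ℝ) 1) ⊆
      (Set.Icc 0 w.1 ×ˢ Set.Icc z.2 1) ∪ ((Set.Icc 0 z.2 ×ˢ Set.Icc w.1 1).preimage Prod.swap ∪
        Set.Icc z.1 w.1 ×ˢ Set.Icc w.2 z.2) := by
    rintro ⟨s, t⟩ ⟨⟨hvz, hvw, hv⟩, ⟨hs0, hs1⟩, ht0, ht1⟩
    obtain ⟨a, y⟩ := z
    obtain ⟨x, b⟩ := w
    simp only [Prod.mk_le_mk, Prod.mk.injEq, Prod.mk_sup_mk, sup_of_le_right h1,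
      sup_of_le_left h2, Set.mem_union, Set.mem_prod, Set.mem_Icc, Set.mem_preimage,
      Prod.swap_prod_mk] at *
    by_cases h3 : x ≤ s <;> by_cases h4 : y ≤ t
    · exact absurd ⟨h3, h4⟩ hv
    · exact Or.inr (Or.inl ⟨⟨ht0, (not_le.1 h4).le⟩, h3, hs1⟩)
    · exact Or.inl ⟨⟨hs0, (not_le.1 h3).le⟩, h4, ht1⟩
    · rw [not_le] at h3 h4
      refine Or.inr (Or.inr ⟨⟨?_, h3.le⟩, ?_, h4.le⟩)
      · by_contra h5
        exact h4.ne (hvz ⟨(not_le.1 h5).le, h4.le⟩).2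
      · by_contra h5
        exact h3.ne (hvw ⟨h3.le, (not_le.1 h5).le⟩).1
  refine (measure_mono h).trans ((measure_union_le _ _).trans
    ((add_le_add_right (measure_union_le _ _) _).trans (le_of_eq ?_)))
  obtain ⟨⟨hz0, hz1⟩, hz2, hz3⟩ := hz
  obtain ⟨⟨hw0, hw1⟩, hw2, hw3⟩ := hw
  have h3 := sub_nonneg.2 h1
  have h4 := sub_nonneg.2 h2
  have h5 := sub_nonneg.2 hz3
  have h6 := sub_nonneg.2 hw1
  rw [Set.preimage_swap_prod, Measure.volume_eq_prod, Measure.prod_prod, Measure.prod_prod,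
    Measure.prod_prod]
  simp only [Real.volume_Icc, sub_zero]
  rw [ENNReal.ofReal_add (by positivity) (by positivity),
    ENNReal.ofReal_add (by positivity) (by positivity), ENNReal.ofReal_mul hw0,
    ENNReal.ofReal_mul hz2, ENNReal.ofReal_mul h3, mul_comm (ENNReal.ofReal (1 - w.1))]

theorem measurableSet_minimal_pair {n : ℕ} (i j : Fin n) (D : Finset (Fin n)) :
    MeasurableSet {q : Fin n → ℝ × ℝ |
        (∀ t, q t ≤ q i → q t = q i) ∧
        (∀ t, q t ≤ q j → q t = q j) ∧
        ∀ t, t ≠ i → t ≠ j → (t ∈ D ↔ ¬ q i ⊔ q j ≤ q t)} := by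
  have hle : ∀ s t : Fin n, MeasurableSet {q : Fin n → ℝ × ℝ | q s ≤ q t} := fun s t =>
    measurableSet_le (measurable_pi_apply s) (measurable_pi_apply t)
  have heq : ∀ s t : Fin n, MeasurableSet {q : Fin n → ℝ × ℝ | q s = q t} := fun s t =>
    measurableSet_eq_fun (measurable_pi_apply s) (measurable_pi_apply t)
  have hsup : ∀ t : Fin n, MeasurableSet {q : Fin n → ℝ × ℝ | q i ⊔ q j ≤ q t} := fun t => by
    simp only [sup_le_iff]
    exact (hle i t).inter (hle j t)
  simp only [measurableSet_setOfPred] at hle heq hsup ⊢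
  exact (Measurable.forall fun t => (hle t i).imp (heq t i)).and
    ((Measurable.forall fun t => (hle t j).imp (heq t j)).and
    (Measurable.forall fun t => Measurable.imp measurable_const
      (Measurable.imp measurable_const (Measurable.iff measurable_const (hsup t).not))))

theorem lmarginal_minimal_pair_le {n : ℕ} {i j : Fin n} (hij : i ≠ j) {D : Finset (Fin n)}
    (hDi : i ∉ D) (hDj : j ∉ D) (x : Fin n → ℝ × ℝ)
    (hi : x i ∈ Set.Icc (0 : ℝ) 1 ×ˢ Set.Icc (0 : ℝ) 1)
    (hj : x j ∈ Set.Icc (0 : ℝ) 1 ×ˢ Set.Icc (0 : ℝ) 1) :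
    lmarginal (fun _ : Fin n => squareMeasure) ((univ.erase i).erase j)
      ({q : Fin n → ℝ × ℝ |
        (∀ t, q t ≤ q i → q t = q i) ∧
        (∀ t, q t ≤ q j → q t = q j) ∧
        ∀ t, t ≠ i → t ≠ j → (t ∈ D ↔ ¬ q i ⊔ q j ≤ q t)}.indicator 1) x ≤
      pairDensity D.card (n - 2 - D.card) (x i) (x j) +
        pairDensity D.card (n - 2 - D.card) (x j) (x i) := by
  set s : Finset (Fin n) := (univ.erase i).erase j with hs
  have his : i ∉ s := by simp [hs]
  have hjs : j ∉ s := by simp [hs]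
  have hDs : D ⊆ s := fun t ht => by
    simp only [hs, mem_erase, mem_univ, and_true]
    exact ⟨fun h => hDj (h ▸ ht), fun h => hDi (h ▸ ht)⟩
  have hcs : s.card = n - 2 := by
    rw [hs, card_erase_of_mem (by simp [hij.symm]), card_erase_of_mem (mem_univ _), card_univ,
      Fintype.card_fin]
    omega
  set A : Set (ℝ × ℝ) := {v | (v ≤ x i → v = x i) ∧ (v ≤ x j → v = x j) ∧ ¬ x i ⊔ x j ≤ v}
  set C : Set (ℝ × ℝ) := Set.Ici (x i ⊔ x j)
  set R := {q : Fin n → ℝ × ℝ |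
        (∀ t, q t ≤ q i → q t = q i) ∧
        (∀ t, q t ≤ q j → q t = q j) ∧
        ∀ t, t ≠ i → t ≠ j → (t ∈ D ↔ ¬ q i ⊔ q j ≤ q t)}
  have hRm : MeasurableSet R := measurableSet_minimal_pair i j D
  have hlm : lmarginal (fun _ : Fin n => squareMeasure) s (R.indicator 1) x =
      Measure.pi (fun _ : s => squareMeasure) {y | Function.updateFinset x s y ∈ R} := by
    exact lintegral_indicator_one (measurable_updateFinset hRm)
  have hsub : {y : s → ℝ × ℝ | Function.updateFinset x s y ∈ R} ⊆
      Set.univ.pi fun t => if (t : Fin n) ∈ D then A else C := by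
    intro y hy t _
    obtain ⟨h1, h2, h3⟩ := hy
    have hxi : Function.updateFinset x s y i = x i := by simp [Function.updateFinset, his]
    have hxj : Function.updateFinset x s y j = x j := by simp [Function.updateFinset, hjs]
    have hyt : Function.updateFinset x s y t = y t := by simp [Function.updateFinset]
    have h1t := h1 t
    have h2t := h2 t
    have h3t := h3 t (fun h => his (h ▸ t.2)) (fun h => hjs (h ▸ t.2))
    rw [hxi, hyt] at h1t
    rw [hxj, hyt] at h2t
    rw [hxi, hxj, hyt] at h3t
    by_cases htD : (t : Fin n) ∈ D
    · simp only [htD, if_true]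
      exact ⟨h1t, h2t, h3t.1 htD⟩
    · simp only [htD, if_false]
      exact not_not.1 fun h => htD (h3t.2 h)
  have hle : lmarginal (fun _ : Fin n => squareMeasure) s (R.indicator 1) x ≤
      squareMeasure A ^ D.card * squareMeasure C ^ (n - 2 - D.card) := by
    rw [hlm]
    refine (measure_mono hsub).trans (le_of_eq ?_)
    rw [Measure.pi_pi, prod_coe_sort s fun t => squareMeasure (if t ∈ D then A else C),
      ← prod_sdiff hDs, mul_comm, prod_congr rfl fun t ht => by rw [if_pos ht], prod_const]
    congr 1
    rw [prod_congr rfl fun t ht => by rw [if_neg (mem_sdiff.1 ht).2], prod_const,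
      card_sdiff_of_subset hDs, hcs]
  have key : ∀ z w : ℝ × ℝ, z ∈ Set.Icc (0 : ℝ) 1 ×ˢ Set.Icc (0 : ℝ) 1 →
      w ∈ Set.Icc (0 : ℝ) 1 ×ˢ Set.Icc (0 : ℝ) 1 → z.1 ≤ w.1 → w.2 ≤ z.2 →
      squareMeasure {v | (v ≤ z → v = z) ∧ (v ≤ w → v = w) ∧ ¬ z ⊔ w ≤ v} ^ D.card *
        squareMeasure (Set.Ici (z ⊔ w)) ^ (n - 2 - D.card) ≤
        pairDensity D.card (n - 2 - D.card) z w := by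
    intro z w hz hw h1 h2
    have hzw : z ⊔ w = (w.1, z.2) := Prod.ext (sup_of_le_right h1) (sup_of_le_left h2)
    have hA := squareMeasure_not_sup_le z w hz hw h1 h2
    have hI : squareMeasure (Set.Ici (z ⊔ w)) ≤ ENNReal.ofReal ((1 - w.1) * (1 - z.2)) :=
      hzw ▸ squareMeasure_Ici_le (w.1, z.2) ⟨hw.1, hz.2⟩
    have h3 := sub_nonneg.2 h1
    have h4 := sub_nonneg.2 h2
    have h5 := sub_nonneg.2 hz.2.2
    have h6 := sub_nonneg.2 hw.1.2
    have h7 := hz.2.1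
    have h8 := hw.1.1
    rw [pairDensity, Set.indicator_of_mem (show ((z, w) : (ℝ × ℝ) × (ℝ × ℝ)) ∈
      {v : (ℝ × ℝ) × (ℝ × ℝ) | v.1.1 ≤ v.2.1 ∧ v.2.2 ≤ v.1.2} from ⟨h1, h2⟩),
      ENNReal.ofReal_mul (by positivity), ENNReal.ofReal_pow (by positivity),
      ENNReal.ofReal_pow (by positivity)]
    gcongr
  by_cases h1 : (x i).1 ≤ (x j).1 ∧ (x j).2 ≤ (x i).2
  · exact (hle.trans (key _ _ hi hj h1.1 h1.2)).trans le_self_add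
  by_cases h2 : (x j).1 ≤ (x i).1 ∧ (x i).2 ≤ (x j).2
  · refine (hle.trans ?_).trans le_add_self
    have hA : A = {v | (v ≤ x j → v = x j) ∧ (v ≤ x i → v = x i) ∧ ¬ x j ⊔ x i ≤ v} := by
      ext v
      rw [sup_comm]
      exact and_left_comm
    have hCI : C = Set.Ici (x j ⊔ x i) := by rw [sup_comm]
    rw [hA, hCI]
    exact key _ _ hj hi h2.1 h2.2
  · have hempty : {y : s → ℝ × ℝ | Function.updateFinset x s y ∈ R} = ∅ := by
      refine Set.eq_empty_of_forall_notMem fun y hy => ?_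
      obtain ⟨h3, h4, -⟩ := hy
      have hxi : Function.updateFinset x s y i = x i := by simp [Function.updateFinset, his]
      have hxj : Function.updateFinset x s y j = x j := by simp [Function.updateFinset, hjs]
      have h3j := h3 j
      have h4i := h4 i
      rw [hxi, hxj] at h3j h4i
      rw [not_and_or, not_le, not_le] at h1 h2
      rcases h1 with h1 | h1 <;> rcases h2 with h2 | h2
      · exact lt_asymm h1 h2
      · exact h1.ne (congrArg Prod.fst (h3j ⟨h1.le, h2.le⟩))
      · exact h2.ne (congrArg Prod.fst (h4i ⟨h2.le, h1.le⟩))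
      · exact lt_asymm h1 h2
    rw [hlm, hempty, measure_empty]
    exact zero_le

theorem measure_minimal_pair_le {n : ℕ} {i j : Fin n} (hij : i ≠ j) {D : Finset (Fin n)}
    (hDi : i ∉ D) (hDj : j ∉ D) :
    Measure.pi (fun _ : Fin n => squareMeasure)
      {q : Fin n → ℝ × ℝ |
        (∀ t, q t ≤ q i → q t = q i) ∧
        (∀ t, q t ≤ q j → q t = q j) ∧
        ∀ t, t ≠ i → t ≠ j → (t ∈ D ↔ ¬ q i ⊔ q j ≤ q t)} ≤
      2 * ∫⁻ z, ∫⁻ w, pairDensity D.card (n - 2 - D.card) z w ∂squareMeasure ∂squareMeasure := by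
  have hRm := measurableSet_minimal_pair i j D
  have hf := (measurable_one (α := ENNReal)).indicator hRm
  have huniv : (univ : Finset (Fin n)) = insert i (insert j ((univ.erase i).erase j)) := by
    rw [insert_erase (by simp [hij.symm]), insert_erase (mem_univ i)]
  rw [← lintegral_indicator_one hRm, lintegral_eq_lmarginal_univ (fun _ => (0 : ℝ × ℝ)), huniv,
    lmarginal_insert _ hf (by simp [hij])]
  have hmeas := measurable_pairDensity D.card (n - 2 - D.card)
  calc _ ≤ ∫⁻ z, ∫⁻ w, (pairDensity D.card (n - 2 - D.card) z w +
        pairDensity D.card (n - 2 - D.card) w z) ∂squareMeasure ∂squareMeasure := by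
        refine setLIntegral_mono' measurableSet_square fun z hz => ?_
        rw [lmarginal_insert _ hf (by simp)]
        refine setLIntegral_mono' measurableSet_square fun w hw => ?_
        set x := Function.update (Function.update (fun _ : Fin n => (0 : ℝ × ℝ)) i z) j w
        have hxj : x j = w := by simp [x]
        have hxi : x i = z := by simp [x, hij]
        have := lmarginal_minimal_pair_le hij hDi hDj x (hxi ▸ hz) (hxj ▸ hw)
        rwa [hxi, hxj] at this
    _ = _ := by
        have hadd : ∀ z : ℝ × ℝ, ∫⁻ w, (pairDensity D.card (n - 2 - D.card) z w +
            pairDensity D.card (n - 2 - D.card) w z) ∂squareMeasure =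
            ∫⁻ w, pairDensity D.card (n - 2 - D.card) z w ∂squareMeasure +
            ∫⁻ w, pairDensity D.card (n - 2 - D.card) w z ∂squareMeasure := fun z =>
          lintegral_add_left (hmeas.comp measurable_prodMk_left) _
        simp only [hadd]
        rw [lintegral_add_left hmeas.lintegral_prod_right, two_mul]
        congr 1
        exact lintegral_lintegral_swap (hmeas.comp measurable_swap).aemeasurable

end MinimalPairs

/-- The estimate on `Pr[R_{i,j,D}]` from the proof of Proposition 4.1: if `i ≠ j`,
`D ⊆ [n] \ {i,j}` with `|D| = k`, and `R_{i,j,D}` is the event that `q_i, q_j` are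
minimal in `{q_1,…,q_n}` and `D = {t ≠ i,j : q_t ≱ q_i ∨ q_j}`, then for `n` i.i.d.
uniform points in `[0,1]²`,
`Pr[R_{i,j,D}] ≤ (20/(k+2)) C(n,2)⁻¹ C(n-2,k)⁻¹ (1 + log(k+1))`. -/
theorem permutation_complex_R_prob_bound (n : ℕ) (hn : 2 ≤ n) (i j : Fin n)
    (hij : i ≠ j) (D : Finset (Fin n)) (hDi : i ∉ D) (hDj : j ∉ D)
    (k : ℕ) (hk : k = D.card) :
    (Measure.pi fun _ : Fin n =>
        volume.restrict (Set.Icc (0 : ℝ) 1 ×ˢ Set.Icc (0 : ℝ) 1))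
      {q : Fin n → ℝ × ℝ |
        (∀ t, q t ≤ q i → q t = q i) ∧
        (∀ t, q t ≤ q j → q t = q j) ∧
        ∀ t, t ≠ i → t ≠ j → (t ∈ D ↔ ¬ q i ⊔ q j ≤ q t)}
      ≤ ENNReal.ofReal (20 / ((k : ℝ) + 2) * ((n.choose 2 : ℝ))⁻¹ *
          (((n - 2).choose k : ℝ))⁻¹ * (1 + Real.log ((k : ℝ) + 1))) := by
  subst hk
  have hcard : D.card ≤ n - 2 := by
    have h := Finset.card_le_card (Finset.subset_univ (insert i (insert j D)))
    rw [Finset.card_insert_of_notMem (by simp [hij, hDi]), Finset.card_insert_of_notMem hDj,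
      Finset.card_univ, Fintype.card_fin] at h
    omega
  refine (measure_minimal_pair_le hij hDi hDj).trans ?_
  refine (mul_le_mul_right (lintegral_pairDensity_le D.card (n - 2 - D.card)) 2).trans ?_
  obtain ⟨m, hm⟩ : ∃ m, n = 2 + (D.card + m) := ⟨n - 2 - D.card, by omega⟩
  generalize D.card = k at *
  rw [show n - 2 - k = m by omega, show n - 2 = k + m by omega, hm, Nat.cast_add_choose,
    Nat.cast_add_choose, ← ENNReal.ofReal_ofNat 2, ← ENNReal.ofReal_mul zero_le_two,
    show m + k + 2 = 2 + (k + m) by ring]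
  refine ENNReal.ofReal_le_ofReal ?_
  have hlog : 0 ≤ Real.log ((k : ℝ) + 1) := Real.log_nonneg (by simp)
  calc _ = 16 / ((k : ℝ) + 4) * (k.factorial * m.factorial / (2 + (k + m)).factorial) *
        (1 + Real.log (k + 1)) := by ring
    _ ≤ 40 / ((k : ℝ) + 2) * (k.factorial * m.factorial / (2 + (k + m)).factorial) *
        (1 + Real.log (k + 1)) := by gcongr <;> norm_num
    _ = _ := by
        rw [Nat.factorial_two]
        push_cast
        field_simp
        norm_num
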